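/- If t is a closed normal term of star type ρ* in the star combinatory calculus for arithmetic, then t is set-like, and SM(t) is a finite nonempty set of closed normal terms of type ρ. -/

import Mathlib

namespace StarArith

/-- Finite types over the ground type `N`, closed under `→` and `*`. -/
inductive Ty : Type where
  | ground : Ty          -- the type `N` of natural numbers
  | arrow : Ty → Ty → Ty
  | star : Ty → Ty
deriving DecidableEq, Repr

/-- Terms of the star combinatory calculus for arithmetic. -/
inductive ATerm : Ty → Type where
  | var (n : ℕ) (σ : Ty) : ATerm σ
  | zero : ATerm .ground
  | succ : ATerm (Ty.ground.arrow .ground)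
  | recr (σ : Ty) :
      ATerm (Ty.ground.arrow (σ.arrow ((σ.arrow (Ty.ground.arrow σ)).arrow σ)))
  | pi (σ τ : Ty) : ATerm (σ.arrow (τ.arrow σ))
  | sigma (ρ σ τ : Ty) :
      ATerm ((ρ.arrow (σ.arrow τ)).arrow ((ρ.arrow σ).arrow (ρ.arrow τ)))
  | sing (σ : Ty) : ATerm (σ.arrow σ.star)
  | union (σ : Ty) : ATerm (σ.star.arrow (σ.star.arrow σ.star))
  | bigUnion (σ τ : Ty) : ATerm (σ.star.arrow ((σ.arrow τ.star).arrow τ.star))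
  | app {σ τ : Ty} (t : ATerm (σ.arrow τ)) (q : ATerm σ) : ATerm τ

/-- One-step reduction: apply one of the conversions
`Σtqr ⇝ tr(qr)`, `Πtq ⇝ t`, `⋃(𝔰t)q ⇝ qt`, `⋃(∪tq)r ⇝ ∪(⋃tr)(⋃qr)`,
`R0qr ⇝ q`, `R(St)qr ⇝ r(Rtqr)t` to a subterm. -/
inductive Step : {σ : Ty} → ATerm σ → ATerm σ → Prop where
  | sigma {ρ σ τ : Ty} (t : ATerm (ρ.arrow (σ.arrow τ))) (q : ATerm (ρ.arrow σ))
      (r : ATerm ρ) :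
      Step ((((ATerm.sigma ρ σ τ).app t).app q).app r) ((t.app r).app (q.app r))
  | pi {σ τ : Ty} (t : ATerm σ) (q : ATerm τ) :
      Step (((ATerm.pi σ τ).app t).app q) t
  | bigUnion_sing {σ τ : Ty} (t : ATerm σ) (q : ATerm (σ.arrow τ.star)) :
      Step (((ATerm.bigUnion σ τ).app ((ATerm.sing σ).app t)).app q) (q.app t)
  | bigUnion_union {σ τ : Ty} (t q : ATerm σ.star) (r : ATerm (σ.arrow τ.star)) :
      Step (((ATerm.bigUnion σ τ).app (((ATerm.union σ).app t).app q)).app r)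
        (((ATerm.union τ).app (((ATerm.bigUnion σ τ).app t).app r)).app
          (((ATerm.bigUnion σ τ).app q).app r))
  | rec_zero {σ : Ty} (q : ATerm σ) (r : ATerm (σ.arrow (Ty.ground.arrow σ))) :
      Step ((((ATerm.recr σ).app .zero).app q).app r) q
  | rec_succ {σ : Ty} (t : ATerm .ground) (q : ATerm σ)
      (r : ATerm (σ.arrow (Ty.ground.arrow σ))) :
      Step ((((ATerm.recr σ).app (ATerm.succ.app t)).app q).app r)
        ((r.app ((((ATerm.recr σ).app t).app q).app r)).app t)
  | app_left {σ τ : Ty} {t t' : ATerm (σ.arrow τ)} (q : ATerm σ) :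
      Step t t' → Step (t.app q) (t'.app q)
  | app_right {σ τ : Ty} (t : ATerm (σ.arrow τ)) {q q' : ATerm σ} :
      Step q q' → Step (t.app q) (t.app q')

/-- `t ⪰ q` : `t` reduces to `q` by finitely many (possibly zero) one-step reductions. -/
def Reduces {σ : Ty} (t q : ATerm σ) : Prop :=
  Relation.ReflTransGen Step t q

/-- A term is normal if no one-step reduction applies to it. -/
def Normal {σ : Ty} (t : ATerm σ) : Prop :=
  ∀ q : ATerm σ, ¬ Step t q

/-- A term is strongly normalizable if there is no infinite chain of one-step
reductions starting from it. -/
def SN {σ : Ty} (t : ATerm σ) : Prop :=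
  ¬ ∃ f : ℕ → ATerm σ, f 0 = t ∧ ∀ n : ℕ, Step (f n) (f (n + 1))

/-- A term is closed if it contains no variables. -/
def ATerm.ClosedT : {σ : Ty} → ATerm σ → Prop
  | _, .var _ _ => False
  | _, .app t q => t.ClosedT ∧ q.ClosedT
  | _, _ => True

/-- A term of star type is set-like if it is constructed solely from terms of the
form `𝔰q` and the constant `∪`. -/
inductive SetLike : {σ : Ty} → ATerm σ.star → Prop where
  | sing {σ : Ty} (q : ATerm σ) : SetLike ((ATerm.sing σ).app q)
  | union {σ : Ty} {t₁ t₂ : ATerm σ.star} :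
      SetLike t₁ → SetLike t₂ → SetLike (((ATerm.union σ).app t₁).app t₂)

/-- `SMem s t` : `s` is a surface element of the star-type term `t`, i.e. `s ∈ SM(t)`
where `SM(𝔰q) = {q}`, `SM(∪qr) = SM(q) ∪ SM(r)` and `SM(t) = ∅` otherwise. -/
inductive SMem : {σ : Ty} → ATerm σ → ATerm σ.star → Prop where
  | sing {σ : Ty} (q : ATerm σ) : SMem q ((ATerm.sing σ).app q)
  | unionL {σ : Ty} {s : ATerm σ} {a b : ATerm σ.star} :
      SMem s a → SMem s (((ATerm.union σ).app a).app b)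
  | unionR {σ : Ty} {s : ATerm σ} {a b : ATerm σ.star} :
      SMem s b → SMem s (((ATerm.union σ).app a).app b)

/-- Tait-style reducibility, defined by recursion on the type: at ground type `N`,
reducible = strongly normalizable; at `σ → τ`, `t` is reducible iff `tq` is
reducible for every reducible `q`; at `σ*`, `t` is reducible iff `t` is strongly
normalizable and all surface elements of all terms obtained by reduction of `t` are
reducible. -/
def Red : {σ : Ty} → ATerm σ → Prop
  | .ground, t => SN t
  | .arrow σ _, t => ∀ q : ATerm σ, Red q → Red (t.app q)
  | .star σ, t => SN t ∧ ∀ q : ATerm σ.star, Reduces t q → ∀ s : ATerm σ, SMem s q → Red s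

/-- The numeral `S(S(⋯(S0)))` for the natural number `n`. -/
def numeral : ℕ → ATerm .ground
  | 0 => .zero
  | n + 1 => ATerm.succ.app (numeral n)

end StarArith

namespace StarArith

theorem Normal.of_app {σ τ : Ty} {t : ATerm (σ.arrow τ)} {q : ATerm σ}
    (h : Normal (t.app q)) : Normal t ∧ Normal q :=
  ⟨fun _ hs => h _ (.app_left q hs), fun _ hs => h _ (.app_right t hs)⟩

/-- The shapes of closed normal terms: a constant applied to too few arguments for a conversion
to apply, or a constructor (`0`, `S`, `𝔰`, `∪`) applied to arguments. -/
inductive Value : {σ : Ty} → ATerm σ → Prop where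
  | zero : Value .zero
  | succ : Value .succ
  | succ_app {n : ATerm .ground} : Value n → Value (ATerm.succ.app n)
  | recr (σ : Ty) : Value (.recr σ)
  | recr_app {σ : Ty} {n : ATerm .ground} : Value n → Value ((ATerm.recr σ).app n)
  | recr_app_app {σ : Ty} {n : ATerm .ground} (q : ATerm σ) :
      Value n → Value (((ATerm.recr σ).app n).app q)
  | pi (σ τ : Ty) : Value (.pi σ τ)
  | pi_app {σ τ : Ty} (t : ATerm σ) : Value ((ATerm.pi σ τ).app t)
  | sigma (ρ σ τ : Ty) : Value (.sigma ρ σ τ)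
  | sigma_app {ρ σ τ : Ty} (t : ATerm (ρ.arrow (σ.arrow τ))) :
      Value ((ATerm.sigma ρ σ τ).app t)
  | sigma_app_app {ρ σ τ : Ty} (t : ATerm (ρ.arrow (σ.arrow τ))) (q : ATerm (ρ.arrow σ)) :
      Value (((ATerm.sigma ρ σ τ).app t).app q)
  | sing (σ : Ty) : Value (.sing σ)
  | sing_app {σ : Ty} (q : ATerm σ) : Value ((ATerm.sing σ).app q)
  | union (σ : Ty) : Value (.union σ)
  | union_app {σ : Ty} {a : ATerm σ.star} : Value a → Value ((ATerm.union σ).app a)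
  | union_app_app {σ : Ty} {a b : ATerm σ.star} :
      Value a → Value b → Value (((ATerm.union σ).app a).app b)
  | bigUnion (σ τ : Ty) : Value (.bigUnion σ τ)
  | bigUnion_app {σ τ : Ty} {a : ATerm σ.star} :
      Value a → Value ((ATerm.bigUnion σ τ).app a)

theorem Value.app {σ τ : Ty} {t : ATerm (σ.arrow τ)} {q : ATerm σ}
    (ht : Value t) (hq : Value q) (hn : Normal (t.app q)) : Value (t.app q) := by
  cases ht with
  | succ => exact .succ_app hq
  | recr => exact .recr_app hq
  | recr_app h => exact .recr_app_app _ h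
  | recr_app_app _ h =>
    cases h with
    | zero => exact absurd (.rec_zero _ _) (hn _)
    | succ_app _ => exact absurd (.rec_succ _ _ _) (hn _)
  | pi => exact .pi_app _
  | pi_app => exact absurd (.pi _ _) (hn _)
  | sigma => exact .sigma_app _
  | sigma_app => exact .sigma_app_app _ _
  | sigma_app_app => exact absurd (.sigma _ _ _) (hn _)
  | sing => exact .sing_app _
  | union => exact .union_app hq
  | union_app h => exact .union_app_app h hq
  | bigUnion => exact .bigUnion_app hq
  | bigUnion_app h =>
    cases h with
    | sing_app => exact absurd (.bigUnion_sing _ _) (hn _)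
    | union_app_app _ _ => exact absurd (.bigUnion_union _ _ _) (hn _)

theorem Value.of_closed_normal {σ : Ty} {t : ATerm σ} (hc : t.ClosedT) (hn : Normal t) :
    Value t := by
  induction t with
  | var => exact hc.elim
  | zero => exact .zero
  | succ => exact .succ
  | recr => exact .recr _
  | pi => exact .pi _ _
  | sigma => exact .sigma _ _ _
  | sing => exact .sing _
  | union => exact .union _
  | bigUnion => exact .bigUnion _ _
  | app t q iht ihq => exact (iht hc.1 hn.of_app.1).app (ihq hc.2 hn.of_app.2) hn

theorem Value.setLike {σ : Ty} : {t : ATerm σ.star} → Value t → SetLike t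
  | _, .sing_app q => .sing q
  | _, .union_app_app ha hb => .union ha.setLike hb.setLike

theorem SetLike.exists_sMem {σ : Ty} {t : ATerm σ.star} (h : SetLike t) : ∃ s, SMem s t := by
  induction h with
  | sing q => exact ⟨q, .sing q⟩
  | union _ _ ih _ => exact ih.imp fun _ => .unionL

theorem SetLike.finite_sMem {σ : Ty} {t : ATerm σ.star} (h : SetLike t) :
    {s | SMem s t}.Finite := by
  induction h with
  | sing q =>
    refine (Set.finite_singleton q).subset fun s hs => ?_
    cases hs
    rfl
  | union _ _ iha ihb =>
    refine (iha.union ihb).subset fun s hs => ?_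
    cases hs with
    | unionL h => exact .inl h
    | unionR h => exact .inr h

theorem SMem.closedT_and_normal {σ : Ty} {s : ATerm σ} {t : ATerm σ.star} (h : SMem s t)
    (hc : t.ClosedT) (hn : Normal t) : s.ClosedT ∧ Normal s := by
  induction h with
  | sing => exact ⟨hc.2, hn.of_app.2⟩
  | unionL _ ih => exact ih hc.1.2 hn.of_app.1.of_app.2
  | unionR _ ih => exact ih hc.2 hn.of_app.2

end StarArith

open StarArith in
/-- If `t` is a closed normal term of star type `ρ*` in the star
combinatory calculus for arithmetic, then `t` is set-like and `SM(t)` is a finite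
nonempty set of closed normal terms of type `ρ`. -/
theorem closed_normal_star_term_setlike_and_SM
    {ρ : Ty} (t : ATerm ρ.star) (hclosed : t.ClosedT) (hnormal : Normal t) :
    SetLike t ∧
    {s : ATerm ρ | SMem s t}.Finite ∧
    (∃ s : ATerm ρ, SMem s t) ∧
    (∀ s : ATerm ρ, SMem s t → s.ClosedT ∧ Normal s) := by
  have hs : SetLike t := (Value.of_closed_normal hclosed hnormal).setLike
  exact ⟨hs, hs.finite_sMem, hs.exists_sMem, fun _ h => h.closedT_and_normal hclosed hnormal⟩
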